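/- Let G₄ be the 6×6 matrix (1/2)·[2,1,1,0,1,1; 1,2,1,1,0,1; 1,1,2,1,1,2; 0,1,1,2,1,1; 1,0,1,1,2,1; 1,1,2,1,1,2] and N=(N₁,...,N₆)ᵀ. Then ∑_{N₁,...,N₆≥0} q^{NᵀG₄N - (N₁+N₂+N₆)} / ∏_i (q²;q²)_{N_i} = 4 (q²;q²)_∞² / (q;q)_∞². -/

import Mathlib

open scoped BigOperators

/-- Finite q-Pochhammer symbol $(a;q)_n$. -/
noncomputable def qPoch (q a : ℂ) (n : ℕ) : ℂ := ∏ j ∈ Finset.range n, (1 - a * q ^ j)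

/-- Infinite q-Pochhammer symbol $(a;q)_\infty$. -/
noncomputable def qPochInf (q a : ℂ) : ℂ := ∏' j : ℕ, (1 - a * q ^ j)

/-- The quadratic form $N^T G_4 N$ for the $6\times 6$ matrix
$G_4=\frac12\begin{pmatrix}2&1&1&0&1&1\\1&2&1&1&0&1\\1&1&2&1&1&2\\0&1&1&2&1&1\\1&0&1&1&2&1\\1&1&2&1&1&2\end{pmatrix}$. -/
def Q4 (n₁ n₂ n₃ n₄ n₅ n₆ : ℕ) : ℕ :=
  n₁ ^ 2 + n₂ ^ 2 + n₃ ^ 2 + n₄ ^ 2 + n₅ ^ 2 + n₆ ^ 2 +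
    n₁ * n₂ + n₁ * n₃ + n₁ * n₅ + n₁ * n₆ +
    n₂ * n₃ + n₂ * n₄ + n₂ * n₆ +
    n₃ * n₄ + n₃ * n₅ + 2 * (n₃ * n₆) +
    n₄ * n₅ + n₄ * n₆ + n₅ * n₆

open Filter Topology PowerSeries

lemma qPoch_succ (q a : ℂ) (n : ℕ) : qPoch q a (n + 1) = qPoch q a n * (1 - a * q ^ n) :=
  Finset.prod_range_succ _ _

lemma one_sub_pow_succ_ne_zero {q : ℂ} (hq : ‖q‖ < 1) (n : ℕ) : 1 - q * q ^ n ≠ 0 := by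
  intro h
  have h1 : ‖q ^ (n + 1)‖ = 1 := by
    rw [pow_succ', ← sub_eq_zero.mp h, norm_one]
  rw [norm_pow] at h1
  exact (pow_lt_one₀ (norm_nonneg q) hq n.succ_ne_zero).ne h1

lemma qPoch_self_ne_zero {q : ℂ} (hq : ‖q‖ < 1) (n : ℕ) : qPoch q q n ≠ 0 :=
  Finset.prod_ne_zero_iff.mpr fun j _ => one_sub_pow_succ_ne_zero hq j

lemma summable_norm_neg_mul_pow {q : ℂ} (hq : ‖q‖ < 1) : Summable fun j : ℕ => ‖-(q * q ^ j)‖ := by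
  simp only [norm_neg, norm_mul, norm_pow]
  exact (summable_geometric_of_lt_one (norm_nonneg q) hq).mul_left _

lemma tendsto_qPoch_self {q : ℂ} (hq : ‖q‖ < 1) :
    Tendsto (qPoch q q) atTop (𝓝 (qPochInf q q)) := by
  have h := multipliable_one_add_of_summable (summable_norm_neg_mul_pow hq)
  simp only [← sub_eq_add_neg] at h
  exact h.tendsto_prod_tprod_nat

lemma qPochInf_self_ne_zero {q : ℂ} (hq : ‖q‖ < 1) : qPochInf q q ≠ 0 := by
  have h := tprod_one_add_ne_zero_of_summable (f := fun j : ℕ => -(q * q ^ j))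
    (fun j => by simpa only [← sub_eq_add_neg] using one_sub_pow_succ_ne_zero hq j)
    (summable_norm_neg_mul_pow hq)
  simp only [← sub_eq_add_neg] at h
  exact h

lemma exists_norm_inv_qPoch_self_le {q : ℂ} (hq : ‖q‖ < 1) :
    ∃ C : ℝ, 0 < C ∧ ∀ n, ‖(qPoch q q n)⁻¹‖ ≤ C := by
  have h := ((tendsto_qPoch_self hq).inv₀ (qPochInf_self_ne_zero hq)).norm.bddAbove_range
  obtain ⟨C, hC⟩ := h
  exact ⟨max C 1, by positivity, fun n => (hC ⟨n, rfl⟩).trans (le_max_left _ _)⟩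

lemma qPoch_sq_eq (q : ℂ) (n : ℕ) :
    qPoch (q ^ 2) (q ^ 2) n = qPoch q q n * ∏ j ∈ Finset.range n, (1 + q ^ (j + 1)) := by
  rw [qPoch, qPoch, ← Finset.prod_mul_distrib]
  exact Finset.prod_congr rfl fun j _ => by ring

lemma choose_two_succ (n : ℕ) : (n + 1).choose 2 = n.choose 2 + n := by
  rw [Nat.choose_succ_succ' n 1, Nat.choose_one_right, add_comm]

lemma two_mul_choose_two_add (n : ℕ) : 2 * n.choose 2 + n = n ^ 2 := by
  induction n with
  | zero => rfl
  | succ n ih => rw [choose_two_succ]; linarith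

/-- The `q`-exponential `∑ xⁿ / (q;q)_n`, equal to `1 / (x;q)_∞`. -/
noncomputable def qExpSmall (q : ℂ) : ℂ⟦X⟧ := .mk fun n => (qPoch q q n)⁻¹

/-- The `q`-exponential `∑ q^(n(n-1)/2) xⁿ / (q;q)_n`, equal to `(-x;q)_∞`. -/
noncomputable def qExpBig (q : ℂ) : ℂ⟦X⟧ := .mk fun n => q ^ n.choose 2 * (qPoch q q n)⁻¹

lemma coeff_qExpSmall (q : ℂ) (n : ℕ) : coeff n (qExpSmall q) = (qPoch q q n)⁻¹ := coeff_mk _ _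

lemma coeff_qExpBig (q : ℂ) (n : ℕ) :
    coeff n (qExpBig q) = q ^ n.choose 2 * (qPoch q q n)⁻¹ := coeff_mk _ _

lemma rescale_eq_one_sub_X_mul_iff {q : ℂ} {F : ℂ⟦X⟧} :
    rescale q F = (1 - X) * F ↔
      ∀ n, coeff (n + 1) F * (1 - q * q ^ n) = coeff n F := by
  refine ⟨fun h n => ?_, fun h => ?_⟩
  · have := congrArg (coeff (n + 1)) h
    rw [sub_mul, one_mul, map_sub, coeff_succ_X_mul, coeff_rescale] at this
    linear_combination -this
  · ext n
    cases n with
    | zero => simp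
    | succ n =>
      rw [sub_mul, one_mul, map_sub, coeff_succ_X_mul, coeff_rescale]
      linear_combination - h n

lemma eq_one_add_X_mul_rescale_iff {q : ℂ} {F : ℂ⟦X⟧} :
    F = (1 + X) * rescale q F ↔
      ∀ n, coeff (n + 1) F * (1 - q * q ^ n) = q ^ n * coeff n F := by
  refine ⟨fun h n => ?_, fun h => ?_⟩
  · have := congrArg (coeff (n + 1)) h
    rw [add_mul, one_mul, map_add, coeff_succ_X_mul, coeff_rescale, coeff_rescale] at this
    linear_combination this
  · ext n
    cases n with
    | zero =>
      rw [add_mul, one_mul, map_add, coeff_zero_X_mul, coeff_rescale]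
      simp
    | succ n =>
      rw [add_mul, one_mul, map_add, coeff_succ_X_mul, coeff_rescale, coeff_rescale]
      linear_combination h n

lemma rescale_qExpSmall {q : ℂ} (hq : ‖q‖ < 1) :
    rescale q (qExpSmall q) = (1 - X) * qExpSmall q := by
  refine rescale_eq_one_sub_X_mul_iff.mpr fun n => ?_
  have h1 := qPoch_self_ne_zero hq n
  have h2 := one_sub_pow_succ_ne_zero hq n
  rw [coeff_qExpSmall, coeff_qExpSmall, qPoch_succ]
  field_simp

lemma qExpBig_eq_mul_rescale {q : ℂ} (hq : ‖q‖ < 1) :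
    qExpBig q = (1 + X) * rescale q (qExpBig q) := by
  refine eq_one_add_X_mul_rescale_iff.mpr fun n => ?_
  have h1 := qPoch_self_ne_zero hq n
  have h2 := one_sub_pow_succ_ne_zero hq n
  rw [coeff_qExpBig, coeff_qExpBig, qPoch_succ, choose_two_succ, pow_add, mul_inv,
    show ∀ a b c d : ℂ, a * b * (c * d⁻¹) * d = a * b * c * (d⁻¹ * d) by intros; ring,
    inv_mul_cancel₀ h2]
  ring

lemma norm_sq_lt_one {q : ℂ} (hq : ‖q‖ < 1) : ‖q ^ 2‖ < 1 := by
  rw [norm_pow]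
  exact pow_lt_one₀ (norm_nonneg q) hq two_ne_zero

lemma rescale_mul_qExpSmall_sq {q : ℂ} (hq : ‖q‖ < 1) :
    rescale q (qExpSmall (q ^ 2)) * qExpSmall (q ^ 2) = qExpSmall q := by
  have hF := rescale_qExpSmall (norm_sq_lt_one hq)
  have hrec := rescale_eq_one_sub_X_mul_iff.mp
    (show rescale q (rescale q (qExpSmall (q ^ 2)) * qExpSmall (q ^ 2)) =
        (1 - X) * (rescale q (qExpSmall (q ^ 2)) * qExpSmall (q ^ 2)) by
      rw [map_mul, rescale_rescale, ← pow_two, hF]; ring)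
  have hrec' := rescale_eq_one_sub_X_mul_iff.mp (rescale_qExpSmall hq)
  ext n
  induction n with
  | zero => simp [-coeff_zero_eq_constantCoeff, coeff_mul, coeff_qExpSmall, coeff_rescale, qPoch]
  | succ n ih =>
    exact mul_right_cancel₀ (one_sub_pow_succ_ne_zero hq n) ((hrec n).trans (ih.trans (hrec' n).symm))

lemma qExpBig_sq_mul_rescale {q : ℂ} (hq : ‖q‖ < 1) :
    qExpBig (q ^ 2) * rescale q (qExpBig (q ^ 2)) = qExpBig q := by
  have hF := qExpBig_eq_mul_rescale (norm_sq_lt_one hq)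
  have hrec := eq_one_add_X_mul_rescale_iff.mp
    (show qExpBig (q ^ 2) * rescale q (qExpBig (q ^ 2)) =
        (1 + X) * rescale q (qExpBig (q ^ 2) * rescale q (qExpBig (q ^ 2))) by
      rw [map_mul, rescale_rescale, ← pow_two]
      nth_rw 1 [hF]
      ring)
  have hrec' := eq_one_add_X_mul_rescale_iff.mp (qExpBig_eq_mul_rescale hq)
  ext n
  induction n with
  | zero => simp [-coeff_zero_eq_constantCoeff, coeff_mul, coeff_qExpBig, coeff_rescale, qPoch]
  | succ n ih =>
    refine mul_right_cancel₀ (one_sub_pow_succ_ne_zero hq n) ((hrec n).trans ?_)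
    rw [ih, hrec' n]

lemma coeff_qExpSmall_mul_qExpBig {q : ℂ} (hq : ‖q‖ < 1) (n : ℕ) :
    coeff n (qExpSmall q * qExpBig q) = qPoch q (-1) n * (qPoch q q n)⁻¹ := by
  have hfun : (1 - X) * (qExpSmall q * qExpBig q) =
      (1 + X) * rescale q (qExpSmall q * qExpBig q) := by
    rw [map_mul, rescale_qExpSmall hq]
    nth_rw 1 [qExpBig_eq_mul_rescale hq]
    ring
  induction n with
  | zero => simp [-coeff_zero_eq_constantCoeff, coeff_mul, coeff_qExpBig, coeff_qExpSmall, qPoch]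
  | succ n ih =>
    have h := congrArg (coeff (n + 1)) hfun
    rw [sub_mul, add_mul, one_mul, one_mul, map_sub, map_add, coeff_succ_X_mul, coeff_succ_X_mul,
      coeff_rescale, coeff_rescale, ih] at h
    have h1 := qPoch_self_ne_zero hq n
    have h2 := one_sub_pow_succ_ne_zero hq n
    refine mul_right_cancel₀ h2 ?_
    rw [qPoch_succ, qPoch_succ, mul_inv,
      show ∀ a b c d : ℂ, a * b * (c * d⁻¹) * d = a * b * c * (d⁻¹ * d) by intros; ring,
      inv_mul_cancel₀ h2]
    linear_combination h

/-- The value `∑ q^(s(s-1)/2) q^(ns) / (q;q)_s` of the `q`-exponential at `qⁿ`. -/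
noncomputable def qExpBigAt (q : ℂ) (n : ℕ) : ℂ := ∑' s, (q ^ n) ^ s * coeff s (qExpBig q)

lemma exists_norm_coeff_qExpBig_le {q : ℂ} (hq : ‖q‖ < 1) (hq0 : q ≠ 0) :
    ∃ C : ℝ, 0 < C ∧ ∀ n, ‖coeff n (qExpBig q)‖ ≤ C * ‖q‖ ^ n := by
  obtain ⟨C, hC0, hC⟩ := exists_norm_inv_qPoch_self_le hq
  have hr : 0 < ‖q‖ := norm_pos_iff.mpr hq0
  refine ⟨C * (‖q‖ ^ 2)⁻¹, by positivity, fun n => ?_⟩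
  rw [coeff_qExpBig, norm_mul, norm_pow]
  have h : ‖q‖ ^ n.choose 2 ≤ (‖q‖ ^ 2)⁻¹ * ‖q‖ ^ n := by
    rw [inv_mul_eq_div, le_div_iff₀ (by positivity), ← pow_add]
    refine pow_le_pow_of_le_one hr.le hq.le ?_
    have := two_mul_choose_two_add n
    by_contra! hlt
    nlinarith
  calc _ ≤ ((‖q‖ ^ 2)⁻¹ * ‖q‖ ^ n) * C := by gcongr; exact hC n
    _ = _ := by ring

lemma summable_norm_coeff_qExpBig {q : ℂ} (hq : ‖q‖ < 1) (hq0 : q ≠ 0) :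
    Summable fun s => ‖coeff s (qExpBig q)‖ := by
  obtain ⟨C, -, hC⟩ := exists_norm_coeff_qExpBig_le hq hq0
  exact .of_nonneg_of_le (fun _ => norm_nonneg _) hC
    ((summable_geometric_of_lt_one (norm_nonneg q) hq).mul_left C)

lemma norm_pow_pow_mul_le {q : ℂ} (hq : ‖q‖ < 1) (n s : ℕ) (z : ℂ) :
    ‖(q ^ n) ^ s * z‖ ≤ ‖z‖ := by
  rw [norm_mul, norm_pow, norm_pow]
  exact mul_le_of_le_one_left (norm_nonneg _)
    (pow_le_one₀ (by positivity) (pow_le_one₀ (norm_nonneg _) hq.le))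

lemma summable_qExpBigAt {q : ℂ} (hq : ‖q‖ < 1) (hq0 : q ≠ 0) (n : ℕ) :
    Summable fun s => (q ^ n) ^ s * coeff s (qExpBig q) :=
  .of_norm_bounded (summable_norm_coeff_qExpBig hq hq0) fun _ => norm_pow_pow_mul_le hq _ _ _

lemma qExpBigAt_eq_mul_succ {q : ℂ} (hq : ‖q‖ < 1) (hq0 : q ≠ 0) (n : ℕ) :
    qExpBigAt q n = (1 + q ^ n) * qExpBigAt q (n + 1) := by
  have hrec := eq_one_add_X_mul_rescale_iff.mp (qExpBig_eq_mul_rescale hq)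
  have h0 := (summable_qExpBigAt hq hq0 n).tsum_eq_zero_add
  have h1 := (summable_qExpBigAt hq hq0 (n + 1)).tsum_eq_zero_add
  have hs := (summable_nat_add_iff 1).mpr (summable_qExpBigAt hq hq0 (n + 1))
  rw [add_mul, one_mul]
  have h2 : q ^ n * qExpBigAt q (n + 1) = _ := tsum_mul_left.symm
  rw [h2, qExpBigAt, qExpBigAt, h0, h1, add_assoc,
    ← hs.tsum_add ((summable_qExpBigAt hq hq0 (n + 1)).mul_left _)]
  congr 1
  refine tsum_congr fun s => ?_
  have := hrec s
  simp only [pow_succ, mul_pow] at this ⊢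
  linear_combination ((q ^ n) ^ s * q ^ n) * this

lemma qPoch_neg_one_mul_qExpBigAt {q : ℂ} (hq : ‖q‖ < 1) (hq0 : q ≠ 0) (n : ℕ) :
    qPoch q (-1) n * qExpBigAt q n = qExpBigAt q 0 := by
  induction n with
  | zero => simp [qPoch]
  | succ n ih =>
    rw [← ih, qPoch_succ, qExpBigAt_eq_mul_succ hq hq0 n]
    ring

lemma tendsto_qExpBigAt {q : ℂ} (hq : ‖q‖ < 1) (hq0 : q ≠ 0) :
    Tendsto (qExpBigAt q) atTop (𝓝 1) := by
  have h := tendsto_tsum_of_dominated_convergence (𝓕 := atTop)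
    (f := fun n s => (q ^ n) ^ s * coeff s (qExpBig q))
    (g := fun s => if s = 0 then (1 : ℂ) else 0)
    (summable_norm_coeff_qExpBig hq hq0) (fun s => ?_)
    (.of_forall fun n s => norm_pow_pow_mul_le hq _ _ _)
  · rwa [tsum_ite_eq] at h
  · rcases eq_or_ne s 0 with rfl | hs
    · simp [-coeff_zero_eq_constantCoeff, coeff_qExpBig, qPoch]
    · have := ((tendsto_pow_atTop_nhds_zero_of_norm_lt_one hq).pow s).mul_const
        (coeff s (qExpBig q))
      simpa [hs] using this

lemma qExpBigAt_zero_eq {q : ℂ} (hq : ‖q‖ < 1) (hq0 : q ≠ 0) :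
    qExpBigAt q 0 = 2 * qPochInf (q ^ 2) (q ^ 2) / qPochInf q q := by
  rw [eq_div_iff (qPochInf_self_ne_zero hq)]
  have hfin (n : ℕ) : qExpBigAt q 0 * qPoch q q n =
      2 * qPoch (q ^ 2) (q ^ 2) n * qExpBigAt q (n + 1) := by
    have h : qPoch q (-1) (n + 1) = 2 * ∏ j ∈ Finset.range n, (1 + q ^ (j + 1)) := by
      rw [qPoch, Finset.prod_range_succ']
      norm_num
      ring
    rw [qPoch_sq_eq, ← qPoch_neg_one_mul_qExpBigAt hq hq0 (n + 1), h]
    ring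
  have hl := (tendsto_qPoch_self hq).const_mul (qExpBigAt q 0)
  have hr := ((tendsto_qPoch_self (norm_sq_lt_one hq)).const_mul 2).mul
    ((tendsto_add_atTop_iff_nat 1).mpr (tendsto_qExpBigAt hq hq0))
  simp only [← hfin, mul_one] at hr
  exact tendsto_nhds_unique hl hr

lemma HasSum.sum_fiberwise {α β : Type*} {f : α → ℂ} {a : ℂ} (hf : HasSum f a) (g : α → β)
    (s : β → Finset α) (hs : ∀ b x, x ∈ s b ↔ g x = b) :
    HasSum (fun b => ∑ x ∈ s b, f x) a := by
  refine (hf.tsum_fiberwise g).congr_fun fun b => ?_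
  have : g ⁻¹' {b} = ↑(s b) := by ext x; simp [hs]
  rw [this, Finset.tsum_subtype']

/-- The summand after grouping the variables as `((n₃, n₆), (n₁, n₄), (n₂, n₅))`. -/
noncomputable def pairedTerm (q : ℂ) (x : (ℕ × ℕ) × (ℕ × ℕ) × (ℕ × ℕ)) : ℂ :=
  let m := x.1.1 + x.1.2
  let s := x.2.1.1 + x.2.1.2
  let t := x.2.2.1 + x.2.2.2
  q ^ (2 * m.choose 2 + m * (s + t) + s * t) *
    (coeff x.1.1 (rescale q (qExpSmall (q ^ 2))) * coeff x.1.2 (qExpSmall (q ^ 2))) *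
    (coeff x.2.1.1 (qExpBig (q ^ 2)) * coeff x.2.1.2 (rescale q (qExpBig (q ^ 2)))) *
    (coeff x.2.2.1 (qExpBig (q ^ 2)) * coeff x.2.2.2 (rescale q (qExpBig (q ^ 2))))

lemma summable_pairedTerm {q : ℂ} (hq : ‖q‖ < 1) (hq0 : q ≠ 0) : Summable (pairedTerm q) := by
  have hq2 := norm_sq_lt_one hq
  obtain ⟨C, hC0, hC⟩ := exists_norm_inv_qPoch_self_le hq2
  obtain ⟨B, hB0, hB⟩ := exists_norm_coeff_qExpBig_le hq2 (pow_ne_zero 2 hq0)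
  have hr : 0 < ‖q‖ := norm_pos_iff.mpr hq0
  have hg := summable_geometric_of_lt_one (norm_nonneg q) hq
  have hg0 : (0 : ℕ → ℝ) ≤ fun n => ‖q‖ ^ n := fun n => by positivity
  have hp := hg.mul_of_nonneg hg hg0 hg0
  have hp0 : (0 : ℕ × ℕ → ℝ) ≤ fun n => ‖q‖ ^ n.1 * ‖q‖ ^ n.2 := fun n => by
    simp only [Pi.zero_apply]; positivity
  have hall := hp.mul_of_nonneg (hp.mul_of_nonneg hp hp0 hp0) hp0
    fun n => by simp only [Pi.zero_apply]; positivity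
  have hbig (n : ℕ) : ‖coeff n (qExpBig (q ^ 2))‖ ≤ B * ‖q‖ ^ n := by
    refine (hB n).trans (mul_le_mul_of_nonneg_left ?_ hB0.le)
    rw [norm_pow, ← pow_mul]
    exact pow_le_pow_of_le_one hr.le hq.le (by omega)
  have hbig' (n : ℕ) : ‖coeff n (rescale q (qExpBig (q ^ 2)))‖ ≤ B * ‖q‖ ^ n := by
    rw [coeff_rescale, norm_mul, norm_pow]
    exact (mul_le_of_le_one_left (norm_nonneg _) (pow_le_one₀ hr.le hq.le)).trans (hbig n)
  have hsmall (n : ℕ) : ‖coeff n (rescale q (qExpSmall (q ^ 2)))‖ ≤ C * ‖q‖ ^ n := by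
    rw [coeff_rescale, norm_mul, norm_pow, coeff_qExpSmall, mul_comm]
    gcongr
    exact hC n
  refine .of_norm_bounded (hall.mul_left (‖q‖⁻¹ * C ^ 2 * B ^ 4)) ?_
  rintro ⟨⟨a, b⟩, ⟨c, d⟩, e, f⟩
  have hexp : ‖q ^ (2 * (a + b).choose 2 + (a + b) * (c + d + (e + f)) + (c + d) * (e + f))‖ ≤
      ‖q‖⁻¹ * ‖q‖ ^ b := by
    rw [inv_mul_eq_div, le_div_iff₀ hr, norm_pow, ← pow_succ]
    refine pow_le_pow_of_le_one hr.le hq.le ?_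
    have h1 := two_mul_choose_two_add (a + b)
    have h2 : b ≤ 2 * (a + b).choose 2 + 1 := by
      by_contra! hlt
      nlinarith
    omega
  simp only [pairedTerm, norm_mul]
  calc _ ≤ (‖q‖⁻¹ * ‖q‖ ^ b) * ((C * ‖q‖ ^ a) * C) * ((B * ‖q‖ ^ c) * (B * ‖q‖ ^ d)) *
        ((B * ‖q‖ ^ e) * (B * ‖q‖ ^ f)) := by
        gcongr
        · exact hsmall a
        · rw [coeff_qExpSmall]; exact hC b
        · exact hbig c
        · exact hbig' d
        · exact hbig e
        · exact hbig' f
    _ = _ := by ring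

lemma tsum_pairedTerm {q : ℂ} (hq : ‖q‖ < 1) (hq0 : q ≠ 0) :
    ∑' x, pairedTerm q x = qExpBigAt q 0 ^ 2 := by
  have h3 : HasSum (fun y : ℕ × ℕ × ℕ =>
      q ^ (2 * y.1.choose 2 + y.1 * (y.2.1 + y.2.2) + y.2.1 * y.2.2) * coeff y.1 (qExpSmall q) *
        coeff y.2.1 (qExpBig q) * coeff y.2.2 (qExpBig q)) (∑' x, pairedTerm q x) := by
    refine ((summable_pairedTerm hq hq0).hasSum.sum_fiberwise
      (fun x => (x.1.1 + x.1.2, x.2.1.1 + x.2.1.2, x.2.2.1 + x.2.2.2))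
      (fun y => Finset.HasAntidiagonal.antidiagonal y.1 ×ˢ Finset.HasAntidiagonal.antidiagonal y.2.1 ×ˢ
        Finset.HasAntidiagonal.antidiagonal y.2.2) ?_).congr_fun ?_
    · rintro ⟨m, s, t⟩ ⟨⟨a, b⟩, ⟨c, d⟩, e, f⟩
      simp
    · rintro ⟨m, s, t⟩
      dsimp only
      rw [← rescale_mul_qExpSmall_sq hq, ← qExpBig_sq_mul_rescale hq, coeff_mul, coeff_mul,
        coeff_mul, mul_assoc, mul_assoc, Finset.sum_mul_sum, ← Finset.sum_product',
        Finset.sum_mul_sum, ← Finset.sum_product', Finset.mul_sum]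
      refine Finset.sum_congr rfl ?_
      rintro ⟨⟨a, b⟩, ⟨c, d⟩, e, f⟩ hx
      simp only [Finset.mem_product, Finset.HasAntidiagonal.mem_antidiagonal] at hx
      obtain ⟨rfl, rfl, rfl⟩ := hx
      simp only [pairedTerm]
      ring
  have h2 : HasSum (fun y : ℕ × ℕ =>
      q ^ y.1.choose 2 * (qPoch q (-1) y.1 * (qPoch q q y.1)⁻¹) *
        ((q ^ y.1) ^ y.2 * coeff y.2 (qExpBig q))) (∑' x, pairedTerm q x) := by
    refine (h3.sum_fiberwise (fun x => (x.2.2 + x.1, x.2.1))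
      (fun y => (Finset.HasAntidiagonal.antidiagonal y.1).image fun z => (z.2, y.2, z.1)) ?_).congr_fun ?_
    · rintro ⟨n, s⟩ ⟨m, s', t⟩
      simp only [Finset.mem_image, Finset.HasAntidiagonal.mem_antidiagonal, Prod.exists, Prod.mk.injEq]
      constructor
      · rintro ⟨_, _, h, rfl, rfl, rfl⟩
        exact ⟨h, rfl⟩
      · rintro ⟨h, rfl⟩
        exact ⟨t, m, h, rfl, rfl, rfl⟩
    · rintro ⟨n, s⟩
      rw [Finset.sum_image (by rintro ⟨_, _⟩ _ ⟨_, _⟩ _ h; simp_all)]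
      dsimp only
      rw [← coeff_qExpSmall_mul_qExpBig hq, coeff_mul, Finset.mul_sum,
        Finset.sum_mul]
      refine Finset.sum_congr rfl ?_
      rintro ⟨t, m⟩ hx
      obtain rfl := Finset.HasAntidiagonal.mem_antidiagonal.mp hx
      have hexp : 2 * m.choose 2 + m * (s + t) + s * t + t.choose 2 =
          (t + m).choose 2 + (t + m) * s + m.choose 2 := by
        have h1 := two_mul_choose_two_add m
        have h2 := two_mul_choose_two_add t
        have h3 := two_mul_choose_two_add (t + m)
        nlinarith
      have hpow := congrArg (q ^ ·) hexp
      simp only [pow_add _ _ (t.choose 2), pow_add _ _ (m.choose 2), pow_add _ ((t + m).choose 2),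
        pow_mul q (t + m)] at hpow
      simp only [coeff_qExpBig, coeff_qExpSmall]
      linear_combination -(qPoch q q m)⁻¹ * (qPoch q q t)⁻¹ *
        (q ^ s.choose 2 * (qPoch q q s)⁻¹) * hpow
  have h1 := h2.prod_fiberwise fun n =>
    ((summable_qExpBigAt hq hq0 n).hasSum.mul_left
      (q ^ n.choose 2 * (qPoch q (-1) n * (qPoch q q n)⁻¹)))
  have h0 := (summable_qExpBigAt hq hq0 0).hasSum.mul_right (qExpBigAt q 0)
  rw [pow_two]
  refine h1.unique (h0.congr_fun fun n => ?_)
  change _ * qExpBigAt q n = _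
  rw [← qPoch_neg_one_mul_qExpBigAt hq hq0 n, coeff_qExpBig, pow_zero, one_pow]
  ring

/-- $\sum_{N_1,\dots,N_6\ge0} q^{N^TG_4N-(N_1+N_2+N_6)}/\prod_i(q^2;q^2)_{N_i}
 = 4(q^2;q^2)_\infty^2/(q;q)_\infty^2$. -/
theorem G4_VOA2 (q : ℂ) (hq : ‖q‖ < 1) (hq0 : q ≠ 0) :
    (∑' n : ℕ × ℕ × ℕ × ℕ × ℕ × ℕ,
        match n with
        | (n₁, n₂, n₃, n₄, n₅, n₆) =>
          q ^ ((Q4 n₁ n₂ n₃ n₄ n₅ n₆ : ℤ) - ((n₁ : ℤ) + n₂ + n₆)) /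
            (qPoch (q ^ 2) (q ^ 2) n₁ * qPoch (q ^ 2) (q ^ 2) n₂ *
              qPoch (q ^ 2) (q ^ 2) n₃ * qPoch (q ^ 2) (q ^ 2) n₄ *
              qPoch (q ^ 2) (q ^ 2) n₅ * qPoch (q ^ 2) (q ^ 2) n₆))
      = 4 * qPochInf (q ^ 2) (q ^ 2) ^ 2 / qPochInf q q ^ 2 := by
  let e : ℕ × ℕ × ℕ × ℕ × ℕ × ℕ ≃ (ℕ × ℕ) × (ℕ × ℕ) × (ℕ × ℕ) :=
    { toFun := fun n => ((n.2.2.1, n.2.2.2.2.2), (n.1, n.2.2.2.1), (n.2.1, n.2.2.2.2.1))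
      invFun := fun x => (x.2.1.1, x.2.2.1, x.1.1, x.2.1.2, x.2.2.2, x.1.2)
      left_inv := fun _ => rfl
      right_inv := fun _ => rfl }
  have hsq : 4 * qPochInf (q ^ 2) (q ^ 2) ^ 2 / qPochInf q q ^ 2 = qExpBigAt q 0 ^ 2 := by
    rw [qExpBigAt_zero_eq hq hq0]
    ring
  rw [hsq, ← tsum_pairedTerm hq hq0, ← e.tsum_eq]
  refine tsum_congr ?_
  rintro ⟨n₁, n₂, n₃, n₄, n₅, n₆⟩
  have hexp : (Q4 n₁ n₂ n₃ n₄ n₅ n₆ : ℤ) - ((n₁ : ℤ) + n₂ + n₆) =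
      ((2 * (n₃ + n₆).choose 2 + (n₃ + n₆) * (n₁ + n₄ + (n₂ + n₅)) + (n₁ + n₄) * (n₂ + n₅) + n₃ +
        2 * n₁.choose 2 + (n₄ + 2 * n₄.choose 2) + 2 * n₂.choose 2 +
        (n₅ + 2 * n₅.choose 2) : ℕ) : ℤ) := by
    have h (n : ℕ) : 2 * (n.choose 2 : ℤ) = n ^ 2 - n := by
      have := two_mul_choose_two_add n
      zify at this
      linarith
    push_cast [Q4]
    simp only [h]
    push_cast
    ring
  dsimp only
  rw [hexp, zpow_natCast]
  simp only [e, Equiv.coe_fn_mk, pairedTerm, coeff_rescale, coeff_qExpBig, coeff_qExpSmall,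
    div_eq_mul_inv, mul_inv, ← pow_mul, pow_add]
  ring
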